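/- Summing over the number of exchanges using the identity ∑_{j≥0} C(m+j-1, j) z^j = (1-z)^{-m} for 0 ≤ z < 1, the probability that an A-served side-out game sequence produces score (α, β) with A scoring last equals p_a^α p_b^β (1-q)^{-(α+β)} ∑_{r=min(β,1)}^{min(α,β)} C(α,r) C(β-1,r-1) q^r, where q = (1-p_a)(1-p_b), with the convention C(-1,-1)=1. -/

import Mathlib

open scoped BigOperators
open Filter

/-- Side-out scoring: a trajectory is the list of rally outcomes, `true` meaning that the
current server wins the rally.  `soScorers srv g` is the list of scorers (`true` = player A),
where `srv` is the current server. -/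
def soScorers : Bool → List Bool → List Bool
  | _, [] => []
  | srv, s :: rest => (if s then [srv] else []) ++ soScorers (if s then srv else !srv) rest

/-- Probability weight of a trajectory of rally outcomes: the server wins a rally with
probability `pa` (if A serves) or `pb` (if B serves); rallies are independent. -/
def soWeight (pa pb : ℝ) : Bool → List Bool → ℝ
  | _, [] => 1
  | srv, s :: rest =>
      (if srv then (if s then pa else 1 - pa) else (if s then pb else 1 - pb)) *
        soWeight pa pb (if s then srv else !srv) rest

/-- Points scored by player A (first server A). -/
def soScoreA (g : List Bool) : ℕ := (soScorers true g).count true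

/-- Points scored by player B (first server A). -/
def soScoreB (g : List Bool) : ℕ := (soScorers true g).count false

/-- The trajectory ends with a rally in which A scores a point. -/
def soLastA (g : List Bool) : Prop :=
  g.getLast? = some true ∧ (soScorers true g).getLast? = some true

/-- The trajectory ends with a rally in which B scores a point. -/
def soLastB (g : List Bool) : Prop :=
  g.getLast? = some true ∧ (soScorers true g).getLast? = some false

/-- Number of maximal runs of `false` in a list, the first argument being the previous value. -/
def falseRuns : Bool → List Bool → ℕ
  | _, [] => 0
  | prev, b :: rest => (if prev && !b then 1 else 0) + falseRuns b rest

/-- Number of A-interruptions: maximal stretches in which B gains the serve from A and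
scores at least one point, i.e. maximal blocks of points scored by B. -/
def soInter (g : List Bool) : ℕ := falseRuns true (soScorers true g)

/-- Number of exchanges: pairs of consecutive rallies in which a player gains the right to
serve and immediately loses it without scoring. -/
def exchCount : List Bool → ℕ
  | [] => 0
  | true :: rest => exchCount rest
  | [false] => 0
  | false :: true :: rest => exchCount rest
  | false :: false :: rest => 1 + exchCount rest

/-- Probability of a set of trajectories in the side-out model, first server A. -/
noncomputable def soPr (pa pb : ℝ) (E : Set (List Bool)) : ℝ :=
  ∑' g : List Bool, Set.indicator E (soWeight pa pb true) g

/-- Conditional expectation of `f` given the event `E` in the side-out model, first server A. -/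
noncomputable def soCondExp (pa pb : ℝ) (E : Set (List Bool)) (f : List Bool → ℝ) : ℝ :=
  (∑' g : List Bool, Set.indicator E (fun g => soWeight pa pb true g * f g) g) / soPr pa pb E

/-- The trajectory `g`, started with server `srv`, scores `a` points for A and `b` points for B,
and its last rally is a point for A. -/
def EndsWithA (srv : Bool) (a b : ℕ) (g : List Bool) : Prop :=
  (soScorers srv g).count true = a ∧ (soScorers srv g).count false = b ∧
    g.getLast? = some true ∧ (soScorers srv g).getLast? = some true

theorem soScorers_ne_nil {g : List Bool} (hg : g.getLast? = some true) (srv : Bool) :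
    soScorers srv g ≠ [] := by
  induction g generalizing srv with
  | nil => simp at hg
  | cons s g ih =>
    cases s with
    | true => simp [soScorers]
    | false =>
      cases g with
      | nil => simp at hg
      | cons t g => simpa [soScorers] using ih (by simpa using hg) (!srv)

theorem not_endsWithA_nil (srv : Bool) (a b : ℕ) : ¬ EndsWithA srv a b [] := by
  simp [EndsWithA]

theorem not_endsWithA_zero (srv : Bool) (b : ℕ) (g : List Bool) : ¬ EndsWithA srv 0 b g := by
  rintro ⟨h, -, -, h'⟩
  exact List.count_eq_zero.1 h (List.mem_of_getLast? h')

theorem endsWithA_false_cons (srv : Bool) (a b : ℕ) (g : List Bool) :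
    EndsWithA srv a b (false :: g) ↔ EndsWithA (!srv) a b g := by
  cases g <;> simp [EndsWithA, soScorers]

theorem endsWithA_true_true_cons (a b : ℕ) (g : List Bool) :
    EndsWithA true (a + 1) b (true :: g) ↔
      (g = [] ∧ a = 0 ∧ b = 0) ∨ EndsWithA true a b g := by
  cases g with
  | nil => simp [EndsWithA, soScorers, eq_comm]
  | cons t g =>
    simp only [EndsWithA, List.getLast?_cons_cons, reduceCtorEq, false_and, false_or]
    by_cases h : (t :: g).getLast? = some true
    · obtain ⟨u, l, hl⟩ := List.exists_cons_of_ne_nil (soScorers_ne_nil h true)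
      rw [soScorers, if_pos rfl, if_pos rfl, hl]
      simp
    · simp [h]

theorem endsWithA_false_true_cons (a b : ℕ) (g : List Bool) :
    EndsWithA false a (b + 1) (true :: g) ↔ EndsWithA false a b g := by
  cases g with
  | nil => simp [EndsWithA, soScorers]
  | cons t g =>
    simp only [EndsWithA, List.getLast?_cons_cons]
    by_cases h : (t :: g).getLast? = some true
    · obtain ⟨u, l, hl⟩ := List.exists_cons_of_ne_nil (soScorers_ne_nil h false)
      rw [soScorers, if_pos rfl, if_pos rfl, hl]
      simp
    · simp [h]

theorem not_endsWithA_false_zero_true_cons (a : ℕ) (g : List Bool) :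
    ¬ EndsWithA false a 0 (true :: g) := by
  simp [EndsWithA, soScorers]

theorem soWeight_nonneg {pa pb : ℝ} (hpa0 : 0 ≤ pa) (hpa1 : pa ≤ 1) (hpb0 : 0 ≤ pb)
    (hpb1 : pb ≤ 1) (srv : Bool) (g : List Bool) : 0 ≤ soWeight pa pb srv g := by
  induction g generalizing srv with
  | nil => simp [soWeight]
  | cons s g ih =>
    rw [soWeight]
    refine mul_nonneg ?_ (ih _)
    split_ifs <;> linarith

theorem tsum_list_bool (f : List Bool → ENNReal) :
    ∑' g, f g = f [] + (∑' g, f (true :: g) + ∑' g, f (false :: g)) := by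
  let e : Unit ⊕ List Bool ⊕ List Bool ≃ List Bool :=
    { toFun := Sum.elim (fun _ => []) (Sum.elim (List.cons true) (List.cons false))
      invFun := fun l => match l with
        | [] => .inl ()
        | true :: g => .inr (.inl g)
        | false :: g => .inr (.inr g)
      left_inv := by rintro (_ | _ | _) <;> rfl
      right_inv := by rintro (_ | ⟨_ | _, g⟩) <;> rfl }
  rw [← e.tsum_eq, ENNReal.summable.tsum_sum ENNReal.summable,
    ENNReal.summable.tsum_sum ENNReal.summable, tsum_fintype, Fintype.sum_unique]
  rfl

open Classical in
/-- The total weight of the trajectories of length less than `n` in the event `EndsWithA`. -/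
noncomputable def endsWithAMass (pa pb : ℝ) (n : ℕ∞) (srv : Bool) (a b : ℕ) : ENNReal :=
  ∑' g : List Bool,
    if g.length < n ∧ EndsWithA srv a b g then ENNReal.ofReal (soWeight pa pb srv g) else 0

section Mass

variable (pa pb : ℝ) (n : ℕ∞)

theorem length_cons_lt_succ (s : Bool) (g : List Bool) :
    (((s :: g).length : ℕ) : ℕ∞) < n + 1 ↔ (g.length : ℕ∞) < n := by
  rw [List.length_cons, Nat.cast_add, Nat.cast_one]
  exact ENat.add_lt_add_iff_right (by simp)

theorem endsWithAMass_zero (srv : Bool) (b : ℕ) : endsWithAMass pa pb n srv 0 b = 0 := by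
  simp [endsWithAMass, not_endsWithA_zero]

theorem tsum_endsWithA_false_cons (srv : Bool) (a b : ℕ) (c : ℝ) (hc : 0 ≤ c)
    (h : ∀ g, soWeight pa pb srv (false :: g) = c * soWeight pa pb (!srv) g) :
    open Classical in
    (∑' g : List Bool, if ((false :: g).length : ℕ∞) < n + 1 ∧ EndsWithA srv a b (false :: g)
        then ENNReal.ofReal (soWeight pa pb srv (false :: g)) else 0) =
      ENNReal.ofReal c * endsWithAMass pa pb n (!srv) a b := by
  classical
  rw [endsWithAMass, ← ENNReal.tsum_mul_left]
  refine tsum_congr fun g => ?_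
  rw [mul_ite, mul_zero, h, ENNReal.ofReal_mul hc]
  exact if_congr (and_congr (length_cons_lt_succ n _ g) (endsWithA_false_cons srv a b g)) rfl rfl

variable {pa pb}

theorem endsWithAMass_true_succ (hpa0 : 0 ≤ pa) (hpa1 : pa ≤ 1) (hn : 0 < n) (a b : ℕ) :
    endsWithAMass pa pb (n + 1) true (a + 1) b =
      ENNReal.ofReal pa *
          ((if a = 0 ∧ b = 0 then 1 else 0) + endsWithAMass pa pb n true a b) +
        ENNReal.ofReal (1 - pa) * endsWithAMass pa pb n false (a + 1) b := by
  classical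
  rw [endsWithAMass, tsum_list_bool, tsum_endsWithA_false_cons pa pb n true (a + 1) b (1 - pa)
    (by linarith) (fun g => by simp [soWeight])]
  simp only [not_endsWithA_nil, and_false, if_false, zero_add, Bool.not_true]
  congr 1
  rw [endsWithAMass, ← tsum_ite_eq ([] : List Bool)
      (fun _ => if a = 0 ∧ b = 0 then (1 : ENNReal) else 0),
    ← ENNReal.tsum_add, ← ENNReal.tsum_mul_left]
  refine tsum_congr fun g => ?_
  rw [if_congr (and_congr (length_cons_lt_succ n _ g) (endsWithA_true_true_cons a b g)) rfl rfl]
  cases g with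
  | nil => simp [not_endsWithA_nil, soWeight, hn]
  | cons t g => simp [soWeight.eq_2 pa pb true true, ENNReal.ofReal_mul hpa0]

theorem endsWithAMass_false_succ (hpb0 : 0 ≤ pb) (hpb1 : pb ≤ 1) (a b : ℕ) :
    endsWithAMass pa pb (n + 1) false a (b + 1) =
      ENNReal.ofReal pb * endsWithAMass pa pb n false a b +
        ENNReal.ofReal (1 - pb) * endsWithAMass pa pb n true a (b + 1) := by
  classical
  rw [endsWithAMass, tsum_list_bool, tsum_endsWithA_false_cons pa pb n false a (b + 1) (1 - pb)
    (by linarith) (fun g => by simp [soWeight])]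
  simp only [not_endsWithA_nil, and_false, if_false, zero_add, Bool.not_false]
  congr 1
  rw [endsWithAMass, ← ENNReal.tsum_mul_left]
  refine tsum_congr fun g => ?_
  rw [if_congr (and_congr (length_cons_lt_succ n _ g) (endsWithA_false_true_cons a b g)) rfl rfl]
  simp [soWeight, ENNReal.ofReal_mul hpb0]

theorem endsWithAMass_false_zero (hpb1 : pb ≤ 1) (a : ℕ) :
    endsWithAMass pa pb (n + 1) false a 0 =
      ENNReal.ofReal (1 - pb) * endsWithAMass pa pb n true a 0 := by
  classical
  rw [endsWithAMass, tsum_list_bool, tsum_endsWithA_false_cons pa pb n false a 0 (1 - pb)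
    (by linarith) (fun g => by simp [soWeight])]
  simp [not_endsWithA_nil, not_endsWithA_false_zero_true_cons]

theorem ofReal_mul_add_ofReal_mul_le_one {p : ℝ} (hp0 : 0 ≤ p) (hp1 : p ≤ 1) {x y : ENNReal}
    (hx : x ≤ 1) (hy : y ≤ 1) :
    ENNReal.ofReal p * x + ENNReal.ofReal (1 - p) * y ≤ 1 :=
  calc ENNReal.ofReal p * x + ENNReal.ofReal (1 - p) * y
      ≤ ENNReal.ofReal p * 1 + ENNReal.ofReal (1 - p) * 1 := by gcongr
    _ = 1 := by
      rw [mul_one, mul_one, ← ENNReal.ofReal_add hp0 (by linarith)]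
      simp

theorem endsWithAMass_natCast_le_one (hpa0 : 0 ≤ pa) (hpa1 : pa ≤ 1) (hpb0 : 0 ≤ pb)
    (hpb1 : pb ≤ 1) (n : ℕ) (srv : Bool) (a b : ℕ) : endsWithAMass pa pb (n + 1) srv a b ≤ 1 := by
  induction n generalizing srv a b with
  | zero =>
    have h : endsWithAMass pa pb ((0 : ℕ) + 1) srv a b = 0 := by
      rw [endsWithAMass, ENNReal.tsum_eq_zero]
      rintro (_ | ⟨s, g⟩)
      · simp [not_endsWithA_nil]
      · exact if_neg fun h => by simpa using (length_cons_lt_succ _ s g).1 h.1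
    rw [h]
    exact zero_le_one
  | succ n ih =>
    push_cast
    cases srv with
    | true =>
      cases a with
      | zero => simp [endsWithAMass_zero]
      | succ a =>
        rw [endsWithAMass_true_succ _ hpa0 hpa1 (by simp)]
        refine ofReal_mul_add_ofReal_mul_le_one hpa0 hpa1 ?_ (ih _ _ _)
        split_ifs with h
        · simp [h.1, endsWithAMass_zero]
        · simpa using ih _ _ _
    | false =>
      cases b with
      | zero =>
        rw [endsWithAMass_false_zero _ hpb1]
        simpa using ofReal_mul_add_ofReal_mul_le_one hpb0 hpb1 zero_le_one (ih true a 0)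
      | succ b =>
        rw [endsWithAMass_false_succ _ hpb0 hpb1]
        exact ofReal_mul_add_ofReal_mul_le_one hpb0 hpb1 (ih _ _ _) (ih _ _ _)

theorem endsWithAMass_top_le_one (hpa0 : 0 ≤ pa) (hpa1 : pa ≤ 1) (hpb0 : 0 ≤ pb)
    (hpb1 : pb ≤ 1) (srv : Bool) (a b : ℕ) : endsWithAMass pa pb ⊤ srv a b ≤ 1 := by
  classical
  rw [endsWithAMass, ENNReal.tsum_eq_iSup_sum]
  refine iSup_le fun u => ?_
  refine le_trans ?_ (endsWithAMass_natCast_le_one hpa0 hpa1 hpb0 hpb1 (u.sup List.length) srv a b)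
  refine le_trans (Finset.sum_le_sum fun g hg => ?_) (ENNReal.sum_le_tsum u)
  have h : (g.length : ℕ∞) < (u.sup List.length : ℕ) + 1 := by
    exact_mod_cast Nat.lt_succ_of_le (Finset.le_sup (f := List.length) hg)
  simp [h]

end Mass

/-- The number of ways to write `b` as an ordered sum of `r` positive integers. -/
def compositionCount : ℕ → ℕ → ℕ
  | 0, 0 => 1
  | 0, _ + 1 => 0
  | _ + 1, 0 => 0
  | b + 1, r + 1 => b.choose r

theorem compositionCount_succ_succ (b r : ℕ) :
    compositionCount (b + 1) (r + 1) = compositionCount b (r + 1) + compositionCount b r := by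
  cases b <;> cases r <;> simp [compositionCount, Nat.choose_succ_succ, add_comm]

/-- The interruption polynomial `∑ r, C(a, r) C(b - 1, r - 1) q ^ r`. -/
noncomputable def interPoly (q : ℝ) (a b : ℕ) : ℝ :=
  ∑ r ∈ Finset.range (a + 1), (a.choose r : ℝ) * compositionCount b r * q ^ r

theorem interPoly_zero_right (q : ℝ) (a : ℕ) : interPoly q a 0 = 1 := by
  rw [interPoly, Finset.sum_range_succ']
  simp [compositionCount]

theorem interPoly_zero_succ (q : ℝ) (b : ℕ) : interPoly q 0 (b + 1) = 0 := by
  simp [interPoly, compositionCount]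

theorem interPoly_succ_left (q : ℝ) (a b : ℕ) :
    interPoly q (a + 1) b = interPoly q a b +
      ∑ r ∈ Finset.range (a + 1), (a.choose r : ℝ) * compositionCount b (r + 1) * q ^ (r + 1) := by
  have h : interPoly q a b =
      ∑ r ∈ Finset.range (a + 2), (a.choose r : ℝ) * compositionCount b r * q ^ r := by
    simp [Finset.sum_range_succ _ (a + 1), interPoly]
  rw [h, interPoly, Finset.sum_range_succ' _ (a + 1), Finset.sum_range_succ' _ (a + 1),
    add_right_comm, ← Finset.sum_add_distrib]
  congr 1
  · refine Finset.sum_congr rfl fun r _ => ?_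
    rw [Nat.choose_succ_succ]
    push_cast
    ring
  · simp

theorem interPoly_succ_succ (q : ℝ) (a b : ℕ) :
    interPoly q (a + 1) (b + 1) =
      interPoly q a (b + 1) + interPoly q (a + 1) b - (1 - q) * interPoly q a b := by
  rw [interPoly_succ_left, interPoly_succ_left q a b]
  have h : ∑ r ∈ Finset.range (a + 1),
        (a.choose r : ℝ) * compositionCount (b + 1) (r + 1) * q ^ (r + 1) =
      ∑ r ∈ Finset.range (a + 1), (a.choose r : ℝ) * compositionCount b (r + 1) * q ^ (r + 1) +
        q * interPoly q a b := by
    rw [interPoly, Finset.mul_sum, ← Finset.sum_add_distrib]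
    refine Finset.sum_congr rfl fun r _ => ?_
    rw [compositionCount_succ_succ]
    push_cast
    ring
  rw [h]
  ring

theorem interPoly_eq_sum_Icc (q : ℝ) (a b : ℕ) :
    interPoly q a b = ∑ r ∈ Finset.Icc (min b 1) (min a b),
      (a.choose r : ℝ) * ((b - 1).choose (r - 1) : ℝ) * q ^ r := by
  cases b with
  | zero => simp [interPoly_zero_right]
  | succ b =>
    symm
    rw [interPoly]
    refine Finset.sum_subset_zero_on_sdiff ?_ ?_ ?_
    · intro r hr
      simp only [Finset.mem_Icc, Finset.mem_range] at hr ⊢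
      omega
    · intro r hr
      simp only [Finset.mem_sdiff, Finset.mem_Icc, Finset.mem_range] at hr
      cases r with
      | zero => simp [compositionCount]
      | succ r =>
        rw [compositionCount, Nat.choose_eq_zero_of_lt (show b < r by omega)]
        simp
    · intro r hr
      simp only [Finset.mem_Icc] at hr
      cases r with
      | zero => omega
      | succ r => simp [compositionCount]

theorem eq_interPoly_of_recurrence {pa pb : ℝ} {x y : ℕ → ℕ → ℝ}
    (hq : (1 - pa) * (1 - pb) < 1) (hx00 : x 0 0 = 1) (hx0 : ∀ b, x 0 (b + 1) = 0)
    (hx : ∀ a b, x (a + 1) b = pa * x a b + (1 - pa) * y (a + 1) b)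
    (hy0 : ∀ a, y (a + 1) 0 = (1 - pb) * x (a + 1) 0)
    (hy : ∀ a b, y (a + 1) (b + 1) = pb * y (a + 1) b + (1 - pb) * x (a + 1) (b + 1))
    (a b : ℕ) :
    x a b = pa ^ a * pb ^ b / (1 - (1 - pa) * (1 - pb)) ^ (a + b) *
      interPoly ((1 - pa) * (1 - pb)) a b := by
  set q := (1 - pa) * (1 - pb) with hqdef
  have hQ : 1 - q ≠ 0 := by linarith
  induction b generalizing a with
  | zero =>
    induction a with
    | zero => simp [hx00, interPoly_zero_right]
    | succ a ih =>
      have h : (1 - q) * x (a + 1) 0 = pa * x a 0 := by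
        linear_combination hx a 0 + (1 - pa) * hy0 a - x (a + 1) 0 * hqdef
      apply mul_left_cancel₀ hQ
      rw [h, ih]
      simp only [interPoly_zero_right]
      field_simp
      ring
  | succ b ihb =>
    induction a with
    | zero => simp [hx0, interPoly_zero_succ]
    | succ a iha =>
      have h : (1 - q) * x (a + 1) (b + 1) =
          pa * x a (b + 1) + pb * x (a + 1) b - pa * pb * x a b := by
        linear_combination hx a (b + 1) + (1 - pa) * hy a b - x (a + 1) (b + 1) * hqdef -
          pb * hx a b
      apply mul_left_cancel₀ hQ
      rw [h, iha, ihb, ihb, interPoly_succ_succ, show a + 1 + (b + 1) = a + b + 2 by ring,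
        show a + (b + 1) = a + b + 1 by ring, show a + 1 + b = a + b + 1 by ring]
      field_simp
      ring

theorem soPr_eq_toReal_endsWithAMass {pa pb : ℝ} (hpa0 : 0 ≤ pa) (hpa1 : pa ≤ 1) (hpb0 : 0 ≤ pb)
    (hpb1 : pb ≤ 1) (a b : ℕ) :
    soPr pa pb {g : List Bool | soScoreA g = a ∧ soScoreB g = b ∧ soLastA g} =
      (endsWithAMass pa pb ⊤ true a b).toReal := by
  classical
  rw [endsWithAMass, ENNReal.tsum_toReal_eq (fun g => by split_ifs <;> simp), soPr]
  refine tsum_congr fun g => ?_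
  have h : ((g.length : ℕ∞) < ⊤ ∧ EndsWithA true a b g) ↔
      g ∈ {g : List Bool | soScoreA g = a ∧ soScoreB g = b ∧ soLastA g} :=
    and_iff_right (ENat.natCast_lt_top _)
  simp only [h, Set.indicator_apply]
  split_ifs <;> simp [soWeight_nonneg hpa0 hpa1 hpb0 hpb1]

theorem toReal_endsWithAMass_top {pa pb : ℝ} (hpa0 : 0 < pa) (hpa1 : pa ≤ 1) (hpb0 : 0 ≤ pb)
    (hpb1 : pb ≤ 1) (a b : ℕ) :
    (if a = 0 ∧ b = 0 then 1 else 0) + (endsWithAMass pa pb ⊤ true a b).toReal =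
      pa ^ a * pb ^ b / (1 - (1 - pa) * (1 - pb)) ^ (a + b) *
        interPoly ((1 - pa) * (1 - pb)) a b := by
  have hfin (srv : Bool) (a b : ℕ) : endsWithAMass pa pb ⊤ srv a b ≠ ⊤ :=
    ne_top_of_le_ne_top ENNReal.one_ne_top
      (endsWithAMass_top_le_one hpa0.le hpa1 hpb0 hpb1 srv a b)
  refine eq_interPoly_of_recurrence
    (x := fun a b => (if a = 0 ∧ b = 0 then 1 else 0) + (endsWithAMass pa pb ⊤ true a b).toReal)
    (y := fun a b => (endsWithAMass pa pb ⊤ false a b).toReal)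
    (by nlinarith) (by simp [endsWithAMass_zero]) (by simp [endsWithAMass_zero]) ?_ ?_ ?_ a b
  · intro a b
    have h := endsWithAMass_true_succ (pb := pb) ⊤ hpa0.le hpa1 (by simp) a b
    rw [top_add] at h
    have hδ : (if a = 0 ∧ b = 0 then (1 : ENNReal) else 0) ≠ ⊤ := by split_ifs <;> simp
    simp only [h]
    rw [ENNReal.toReal_add (ENNReal.mul_ne_top (by simp) (by simp [hfin, hδ]))
      (ENNReal.mul_ne_top (by simp) (hfin _ _ _)), ENNReal.toReal_mul, ENNReal.toReal_mul,
      ENNReal.toReal_add hδ (hfin _ _ _), ENNReal.toReal_ofReal hpa0.le,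
      ENNReal.toReal_ofReal (by linarith)]
    split_ifs <;> simp_all
  · intro a
    have h := endsWithAMass_false_zero (pa := pa) ⊤ hpb1 (a + 1)
    rw [top_add] at h
    simp [h, hpb1]
  · intro a b
    have h := endsWithAMass_false_succ (pa := pa) ⊤ hpb0 hpb1 (a + 1) b
    rw [top_add] at h
    simp only [h]
    rw [ENNReal.toReal_add (ENNReal.mul_ne_top (by simp) (hfin _ _ _))
      (ENNReal.mul_ne_top (by simp) (hfin _ _ _)), ENNReal.toReal_mul, ENNReal.toReal_mul,
      ENNReal.toReal_ofReal hpb0, ENNReal.toReal_ofReal (by linarith)]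
    simp

theorem stmt_2 (α β : ℕ) (hα : 1 ≤ α) (pa pb : ℝ) (hpa0 : 0 < pa) (hpa1 : pa ≤ 1)
    (hpb0 : 0 ≤ pb) (hpb1 : pb ≤ 1) :
    soPr pa pb {g : List Bool | soScoreA g = α ∧ soScoreB g = β ∧ soLastA g} =
      pa ^ α * pb ^ β / (1 - (1 - pa) * (1 - pb)) ^ (α + β) *
        ∑ r ∈ Finset.Icc (min β 1) (min α β),
          (α.choose r : ℝ) * ((β - 1).choose (r - 1) : ℝ) * ((1 - pa) * (1 - pb)) ^ r := by
  rw [soPr_eq_toReal_endsWithAMass hpa0.le hpa1 hpb0 hpb1, ← interPoly_eq_sum_Icc,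
    ← toReal_endsWithAMass_top hpa0 hpa1 hpb0 hpb1, if_neg (by omega), zero_add]
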